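/- Let w ∈ S_n with z = cc(w), let d be a value occurring in z, and let 1 ≤ p ≤ n+1. Then the word u ∈ ℕ^{n+1} obtained from z by inserting one letter equal to d at position p satisfies u = cc(w̃) for some permutation w̃ ∈ S_{n+1}. -/

import Mathlib

/-- The cocharge label of the value `v` (`0`-indexed, so `v` represents the letter `v+1`)
in the one-line notation of the permutation `w` (`w j` is the letter at position `j`):
the label of the smallest value is `0`, and the label increases by one exactly at those
steps `i → i+1` where the value `i+1` appears to the left of the value `i`. -/
def ccLabel {n : ℕ} (w : Equiv.Perm (Fin n)) (v : Fin n) : ℕ :=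
  (Finset.univ.filter fun i : Fin n =>
    (i : ℕ) + 1 ≤ (v : ℕ) ∧ ∃ h : (i : ℕ) + 1 < n, w.symm ⟨(i : ℕ) + 1, h⟩ < w.symm i).card

/-- The cocharge word of a permutation: `cc w j` is the cocharge label of the letter `w j`
at position `j`. -/
def cc {n : ℕ} (w : Equiv.Perm (Fin n)) : Fin n → ℕ := fun j => ccLabel w (w j)


/-- Every letter `d + 1` of `z` is witnessed by an occurrence of `d + 1` lying to the left of an
occurrence of `d`. This characterizes the cocharge words. -/
def IsCochargeWord {n : ℕ} (z : Fin n → ℕ) : Prop :=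
  ∀ j d, z j = d + 1 → ∃ i k, i < k ∧ z i = d + 1 ∧ z k = d

theorem ccLabel_zero {n : ℕ} (w : Equiv.Perm (Fin n)) (h : 0 < n) : ccLabel w ⟨0, h⟩ = 0 := by
  simp [ccLabel]

theorem ccLabel_succ {n : ℕ} (w : Equiv.Perm (Fin n)) (v : ℕ) (h : v + 1 < n) :
    ccLabel w ⟨v + 1, h⟩ = ccLabel w ⟨v, by omega⟩ +
      if w.symm ⟨v + 1, h⟩ < w.symm ⟨v, by omega⟩ then 1 else 0 := by
  unfold ccLabel
  split_ifs with hlt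
  · rw [← Finset.card_insert_of_notMem (a := (⟨v, by omega⟩ : Fin n)) (by simp)]
    congr 1
    ext i
    simp only [Finset.mem_filter, Finset.mem_univ, true_and, Finset.mem_insert]
    constructor
    · rintro ⟨h1, h2⟩
      by_cases hi : (i : ℕ) = v
      · exact Or.inl (Fin.ext hi)
      · exact Or.inr ⟨by omega, h2⟩
    · rintro (rfl | ⟨h1, h2⟩)
      · exact ⟨le_rfl, h, hlt⟩
      · exact ⟨by omega, h2⟩
  · rw [add_zero]
    congr 1
    ext i
    simp only [Finset.mem_filter, Finset.mem_univ, true_and]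
    constructor
    · rintro ⟨h1, h2⟩
      refine ⟨?_, h2⟩
      by_contra hi
      obtain rfl : (i : ℕ) = v := by omega
      exact hlt h2.2
    · rintro ⟨h1, h2⟩
      exact ⟨by omega, h2⟩

theorem isCochargeWord_cc {n : ℕ} (w : Equiv.Perm (Fin n)) : IsCochargeWord (cc w) := by
  suffices H : ∀ (v : ℕ) (h : v < n) (d : ℕ), ccLabel w ⟨v, h⟩ = d + 1 →
      ∃ i k, i < k ∧ cc w i = d + 1 ∧ cc w k = d from fun j d hj => H (w j) (w j).2 d hj
  intro v
  induction v with
  | zero => intro h d hd; simp [ccLabel_zero] at hd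
  | succ v ih =>
    intro h d hd
    have hs := ccLabel_succ w v h
    split_ifs at hs with hlt
    · refine ⟨_, _, hlt, ?_, ?_⟩ <;> simp only [cc, Equiv.apply_symm_apply] <;> omega
    · exact ih (by omega) d (by omega)

theorem IsCochargeWord.exists_eq_cc {n : ℕ} {z : Fin n → ℕ} (hz : IsCochargeWord z) :
    ∃ w : Equiv.Perm (Fin n), z = cc w := by
  obtain ⟨σ, hσ⟩ : ∃ σ, σ = Tuple.sort z := ⟨_, rfl⟩
  obtain ⟨hmono, hstable⟩ := Tuple.eq_sort_iff.1 hσ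
  have hle : ∀ {a b}, z a < z b → σ.symm a < σ.symm b := fun {a b} hab => by
    by_contra! hba
    have := hmono hba
    simp only [Function.comp_apply, Equiv.apply_symm_apply] at this
    omega
  have hrank : ∀ {a b}, a ≤ b → z (σ a) = z (σ b) → σ a ≤ σ b := fun {a b} hab he => by
    rcases hab.eq_or_lt with rfl | hlt
    · exact le_rfl
    · exact (hstable _ _ hlt he).le
  suffices H : ∀ (v : ℕ) (h : v < n), ccLabel σ.symm ⟨v, h⟩ = z (σ ⟨v, h⟩) by
    refine ⟨σ.symm, funext fun j => ?_⟩
    simpa [cc] using (H (σ.symm j) (σ.symm j).2).symm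
  intro v
  induction v with
  | zero =>
    intro h
    rw [ccLabel_zero]
    rcases hd : z (σ ⟨0, h⟩) with _ | d
    · rfl
    · obtain ⟨i, k, -, -, hk⟩ := hz _ _ hd
      have := hle (a := k) (b := σ ⟨0, h⟩) (by omega)
      simp [Fin.lt_def] at this
  | succ v ih =>
    intro h
    have hv : (⟨v, by omega⟩ : Fin n) < ⟨v + 1, h⟩ := by simp [Fin.lt_def]
    rw [ccLabel_succ, ih, Equiv.symm_symm]
    rcases (hmono hv.le).eq_or_lt with he | hlt
    · simp only [Function.comp_apply] at he
      rw [if_neg (hstable _ _ hv he).not_gt, he, add_zero]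
    · simp only [Function.comp_apply] at hlt
      obtain ⟨d, hd⟩ := Nat.exists_eq_add_one.2 (Nat.zero_lt_of_lt hlt)
      obtain ⟨i, k, hik, hi, hk⟩ := hz _ _ hd
      have hkv : σ.symm k ≤ ⟨v, by omega⟩ := by
        have := hle (a := k) (b := σ ⟨v + 1, h⟩) (by omega)
        simp only [Equiv.symm_apply_apply, Fin.lt_def] at this
        exact Fin.le_def.2 (Nat.le_of_lt_succ this)
      have hiv : ⟨v + 1, h⟩ ≤ σ.symm i := by
        have := hle (a := σ ⟨v, by omega⟩) (b := i) (by omega)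
        simpa [Fin.lt_def, Fin.le_def] using this
      have hzk := hmono hkv
      simp only [Function.comp_apply, Equiv.apply_symm_apply] at hzk
      have hk' := hrank hkv (by rw [Equiv.apply_symm_apply]; omega)
      have hi' := hrank hiv (by rw [Equiv.apply_symm_apply]; omega)
      rw [Equiv.apply_symm_apply] at hk' hi'
      rw [if_pos (hi'.trans_lt (hik.trans_le hk'))]
      omega

theorem IsCochargeWord.insertNth {n : ℕ} {z : Fin n → ℕ} (hz : IsCochargeWord z) {d : ℕ}
    (hd : ∃ j, z j = d) (p : Fin (n + 1)) :
    IsCochargeWord (p.insertNth d z : Fin (n + 1) → ℕ) := by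
  intro j e he
  obtain ⟨j, hj⟩ : ∃ j, z j = e + 1 := by
    induction j using Fin.succAboveCases p with
    | x => simpa [← he] using hd
    | p j => exact ⟨j, by simpa using he⟩
  obtain ⟨i, k, hik, hi, hk⟩ := hz j e hj
  exact ⟨p.succAbove i, p.succAbove k, Fin.strictMono_succAbove p hik, by simpa, by simpa⟩

theorem statement7 (n : ℕ) (w : Equiv.Perm (Fin n)) (d : ℕ) (hd : ∃ j, cc w j = d)
    (p : Fin (n + 1)) :
    ∃ w' : Equiv.Perm (Fin (n + 1)), p.insertNth d (cc w) = cc w' :=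
  ((isCochargeWord_cc w).insertNth hd p).exists_eq_cc
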